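/- arXiv:math/0203132 — 5 statements merged into one kernel-verified Lean document; each statement's English description precedes it below -/
import Mathlib

section
/- The kernel of the group homomorphism ρ : G_K → GL(V_K) induced by the action (i.e., the set of g ∈ G_K with g·x = x for all x ∈ V_K) is exactly the central subgroup {(s⁻², s·I₂) : s ∈ K^×}. -/
open Matrix

/-- The action of `Kˣ × GL₂(K)` on binary quadratic forms `x = (x₀, x₁, x₂)`,
`F_x(z₁,z₂) = x₀z₁² + x₁z₁z₂ + x₂z₂²`, given by
`F_{(t,A)·x}(z₁,z₂) = t · F_x(a z₁ + c z₂, b z₁ + d z₂)`. -/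
def qact {K : Type*} [CommRing K] (g : Kˣ × GL (Fin 2) K) (x : K × K × K) : K × K × K :=
  let t : K := g.1
  let a : K := (g.2 : Matrix (Fin 2) (Fin 2) K) 0 0
  let b : K := (g.2 : Matrix (Fin 2) (Fin 2) K) 0 1
  let c : K := (g.2 : Matrix (Fin 2) (Fin 2) K) 1 0
  let d : K := (g.2 : Matrix (Fin 2) (Fin 2) K) 1 1
  (t * (x.1 * a ^ 2 + x.2.1 * (a * b) + x.2.2 * b ^ 2),
   t * (2 * x.1 * (a * c) + x.2.1 * (a * d + b * c) + 2 * x.2.2 * (b * d)),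
   t * (x.1 * c ^ 2 + x.2.1 * (c * d) + x.2.2 * d ^ 2))

/-- The discriminant `P(x) = x₁² - 4 x₀ x₂`. -/
def disc {K : Type*} [CommRing K] (x : K × K × K) : K := x.2.1 ^ 2 - 4 * x.1 * x.2.2


/-- The kernel of the representation `ρ : G_K → GL(V_K)` is the central subgroup
`{(s⁻², s·I₂) : s ∈ Kˣ}`. -/
theorem stmt1 {K : Type*} [Field K] (hchar : (2 : K) ≠ 0) (g : Kˣ × GL (Fin 2) K) :
    (∀ x : K × K × K, qact g x = x) ↔
      ∃ s : Kˣ, g.1 = (s⁻¹) ^ 2 ∧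
        (g.2 : Matrix (Fin 2) (Fin 2) K) = (s : K) • (1 : Matrix (Fin 2) (Fin 2) K) := by
  obtain ⟨t, A⟩ := g
  constructor
  · intro h
    have h₀ := h (1, 0, 0)
    have h₁ := h (0, 1, 0)
    have h₂ := h (0, 0, 1)
    simp only [qact, Prod.mk.injEq, one_mul, zero_mul, mul_zero, mul_one, add_zero, zero_add]
      at h₀ h₁ h₂
    have ht : (t : K) ≠ 0 := t.ne_zero
    have hc : (A : Matrix (Fin 2) (Fin 2) K) 1 0 = 0 := by simpa [ht] using h₀.2.2
    have hb : (A : Matrix (Fin 2) (Fin 2) K) 0 1 = 0 := by simpa [ht] using h₂.1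
    have haa := h₀.1
    have had := h₁.2.1
    rw [hb, zero_mul, add_zero] at had
    have ha : (A : Matrix (Fin 2) (Fin 2) K) 0 0 ≠ 0 := by
      intro ha
      simp [ha] at haa
    have hd : (A : Matrix (Fin 2) (Fin 2) K) 1 1 = (A : Matrix (Fin 2) (Fin 2) K) 0 0 := by
      apply mul_left_cancel₀ (mul_ne_zero ht ha)
      linear_combination had - haa
    refine ⟨Units.mk0 _ ha, ?_, ?_⟩
    · ext
      simp only [Units.val_pow_eq_pow_val, Units.val_inv_eq_inv_val, Units.val_mk0, inv_pow]
      exact eq_inv_of_mul_eq_one_left haa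
    · ext i j
      fin_cases i <;> fin_cases j <;> simp [hb, hc, hd]
  · rintro ⟨s, hs, hA⟩ ⟨x, y, z⟩
    have hs0 : (s : K) ≠ 0 := s.ne_zero
    dsimp only at hs hA
    simp only [qact, hs, hA, Units.val_pow_eq_pow_val, Units.val_inv_eq_inv_val,
      Matrix.smul_apply, Matrix.one_apply, smul_eq_mul, Prod.mk.injEq]
    refine ⟨?_, ?_, ?_⟩ <;> simp <;> field_simp
end

section
/- An element x ∈ V_K with P(x) ≠ 0 lies in the G_K-orbit of (0,1,0) (the form z₁z₂) if and only if P(x) is a nonzero square in K (equivalently, if and only if F_x splits into a product of two linearly independent linear forms over K). -/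
open Matrix

/-- A product `t (a z₁ + c z₂) (b z₁ + d z₂)` of independent linear forms lies in the orbit
of `z₁z₂`. -/
theorem exists_qact_eq_of_factors {K : Type*} [Field K] {t a b c d : K} (ht : t ≠ 0)
    (hdet : a * d - b * c ≠ 0) :
    ∃ g : Kˣ × GL (Fin 2) K,
      qact g ((0 : K), (1 : K), (0 : K)) = (t * (a * b), t * (a * d + b * c), t * (c * d)) :=
  ⟨(Units.mk0 t ht, GeneralLinearGroup.mkOfDetNeZero !![a, b; c, d] (by rwa [det_fin_two_of])),
    by simp [qact, GeneralLinearGroup.mkOfDetNeZero]⟩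

/-- A nonsingular form `x` lies in the `G_K`-orbit of `(0,1,0)` (the form `z₁z₂`)
if and only if `P(x)` is a (nonzero) square in `K`. -/
theorem stmt4 {K : Type*} [Field K] (hchar : (2 : K) ≠ 0) (x : K × K × K)
    (hx : disc x ≠ 0) :
    (∃ g : Kˣ × GL (Fin 2) K, qact g ((0 : K), (1 : K), (0 : K)) = x) ↔ IsSquare (disc x) := by
  constructor
  · rintro ⟨g, rfl⟩
    refine ⟨(g.1 : K) * (g.2 : Matrix (Fin 2) (Fin 2) K).det, ?_⟩
    simp only [disc, qact, det_fin_two]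
    ring
  · rintro ⟨s, hs⟩
    obtain ⟨x₀, x₁, x₂⟩ := x
    have hs0 : s ≠ 0 := by
      rintro rfl
      exact hx (by rw [hs, mul_zero])
    simp only [disc] at hs
    by_cases h₀ : x₀ = 0
    · subst h₀
      have h₁ : x₁ ≠ 0 := by
        rintro rfl
        simp [disc] at hx
      simpa using exists_qact_eq_of_factors (one_ne_zero (α := K))
        (show 0 * x₂ - x₁ * 1 ≠ 0 by simpa)
    · have hdet : 1 * ((x₁ - s) / (2 * x₀)) - 1 * ((x₁ + s) / (2 * x₀)) ≠ 0 := by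
        rw [show 1 * ((x₁ - s) / (2 * x₀)) - 1 * ((x₁ + s) / (2 * x₀)) = -(s / x₀) by
          field_simp
          ring]
        exact neg_ne_zero.mpr (div_ne_zero hs0 h₀)
      obtain ⟨g, hg⟩ := exists_qact_eq_of_factors h₀ hdet
      refine ⟨g, hg.trans ?_⟩
      simp only [Prod.mk.injEq]
      refine ⟨by ring, ?_, ?_⟩
      · field_simp
        ring
      · field_simp
        linear_combination hs
end

section
/- Let x = (0,1,0) (the form z₁z₂). Then Stab_{G_K}(x) = D ∪ D′, where D = {((αβ)⁻¹, [[α,0],[0,β]]) : α, β ∈ K^×} and D′ = {((βγ)⁻¹, [[0,β],[γ,0]]) : β, γ ∈ K^×}. Moreover D is a subgroup of index 2 in Stab_{G_K}(x), and the map K^× × K^× → D given by (α,β) ↦ ((αβ)⁻¹, diag(α,β)) is a group isomorphism. -/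
open Matrix

/-- `D = {((αβ)⁻¹, diag(α,β))}`. -/
def Dset (K : Type*) [Field K] : Set (Kˣ × GL (Fin 2) K) :=
  {g | ∃ α β : Kˣ, (g.1 : K) = ((α : K) * (β : K))⁻¹ ∧
    (g.2 : Matrix (Fin 2) (Fin 2) K) = !![(α : K), 0; 0, (β : K)]}

/-- `D′ = {((βγ)⁻¹, [[0,β],[γ,0]])}`. -/
def Dset' (K : Type*) [Field K] : Set (Kˣ × GL (Fin 2) K) :=
  {g | ∃ β γ : Kˣ, (g.1 : K) = ((β : K) * (γ : K))⁻¹ ∧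
    (g.2 : Matrix (Fin 2) (Fin 2) K) = !![0, (β : K); (γ : K), 0]}

/-- The element `((αβ)⁻¹, diag(α,β))` as a function of `(α,β)`, bundled as a homomorphism. -/
def diagHom (K : Type*) [Field K] : Kˣ × Kˣ →* Kˣ × GL (Fin 2) K where
  toFun p := ((p.1 * p.2)⁻¹,
    GeneralLinearGroup.mkOfDetNeZero !![(p.1 : K), 0; 0, (p.2 : K)] (by simp [det_fin_two]))
  map_one' := by
    refine Prod.ext (by simp) (Units.ext ?_)
    simp [GeneralLinearGroup.mkOfDetNeZero, one_fin_two]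
  map_mul' p q := by
    refine Prod.ext ?_ (Units.ext ?_)
    · simp only [Prod.fst_mul, Prod.snd_mul]
      rw [← mul_inv, mul_mul_mul_comm]
    · simp [GeneralLinearGroup.mkOfDetNeZero]

/-- The element `((βγ)⁻¹, [[0,β],[γ,0]])`. -/
def antidiag {K : Type*} [Field K] (β γ : Kˣ) : Kˣ × GL (Fin 2) K :=
  ((β * γ)⁻¹,
    GeneralLinearGroup.mkOfDetNeZero !![0, (β : K); (γ : K), 0] (by simp [det_fin_two]))

theorem mem_Dset_iff {K : Type*} [Field K] {g : Kˣ × GL (Fin 2) K} :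
    g ∈ Dset K ↔ ∃ α β : Kˣ, diagHom K (α, β) = g := by
  refine exists₂_congr fun α β => ?_
  rw [Prod.ext_iff, Units.ext_iff, Units.ext_iff, eq_comm (b := (g.1 : K)),
    eq_comm (b := (g.2 : Matrix (Fin 2) (Fin 2) K))]
  simp [diagHom, GeneralLinearGroup.mkOfDetNeZero]

theorem mem_Dset'_iff {K : Type*} [Field K] {g : Kˣ × GL (Fin 2) K} :
    g ∈ Dset' K ↔ ∃ β γ : Kˣ, antidiag β γ = g := by
  refine exists₂_congr fun β γ => ?_
  rw [Prod.ext_iff, Units.ext_iff, Units.ext_iff, eq_comm (b := (g.1 : K)),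
    eq_comm (b := (g.2 : Matrix (Fin 2) (Fin 2) K))]
  simp [antidiag, GeneralLinearGroup.mkOfDetNeZero]

theorem antidiag_mul_diagHom {K : Type*} [Field K] (β γ α δ : Kˣ) :
    antidiag β γ * diagHom K (α, δ) = antidiag (β * δ) (γ * α) := by
  refine Prod.ext ?_ (Units.ext ?_)
  · simp only [antidiag, diagHom, MonoidHom.coe_mk, OneHom.coe_mk, Prod.fst_mul]
    rw [← mul_inv, mul_comm α δ, mul_mul_mul_comm]
  · simp [antidiag, diagHom, GeneralLinearGroup.mkOfDetNeZero]

theorem diagHom_injective (K : Type*) [Field K] : Function.Injective (diagHom K) := by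
  rintro ⟨α, β⟩ ⟨α', β'⟩ h
  have h2 := congrArg (fun g => (g.2 : Matrix (Fin 2) (Fin 2) K)) h
  have h00 := congrFun (congrFun h2 0) 0
  have h11 := congrFun (congrFun h2 1) 1
  exact Prod.ext (Units.ext h00) (Units.ext h11)

theorem qact_eq_self_iff {K : Type*} [Field K] (g : Kˣ × GL (Fin 2) K) :
    qact g ((0 : K), (1 : K), (0 : K)) = ((0 : K), (1 : K), (0 : K)) ↔
      g ∈ Dset K ∪ Dset' K := by
  constructor
  · intro h
    simp only [qact, Prod.mk.injEq, zero_mul, mul_zero, one_mul, zero_add, add_zero,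
      mul_eq_zero, Units.ne_zero, false_or] at h
    obtain ⟨hab, ht, hcd⟩ := h
    have hA := eta_fin_two (g.2 : Matrix (Fin 2) (Fin 2) K)
    generalize (g.2 : Matrix (Fin 2) (Fin 2) K) 0 0 = a at *
    generalize (g.2 : Matrix (Fin 2) (Fin 2) K) 0 1 = b at *
    generalize (g.2 : Matrix (Fin 2) (Fin 2) K) 1 0 = c at *
    generalize (g.2 : Matrix (Fin 2) (Fin 2) K) 1 1 = d at *
    rcases hab with rfl | rfl
    · have hb : b ≠ 0 := by rintro rfl; simp at ht
      have hc : c ≠ 0 := by rintro rfl; simp at ht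
      obtain rfl : d = 0 := hcd.resolve_left hc
      exact Or.inr ⟨Units.mk0 b hb, Units.mk0 c hc,
        eq_inv_of_mul_eq_one_left (by simpa using ht), hA⟩
    · have ha : a ≠ 0 := by rintro rfl; simp at ht
      have hd : d ≠ 0 := by rintro rfl; simp at ht
      obtain rfl : c = 0 := hcd.resolve_right hd
      exact Or.inl ⟨Units.mk0 a ha, Units.mk0 d hd,
        eq_inv_of_mul_eq_one_left (by simpa using ht), hA⟩
  · rintro (⟨α, β, ht, hA⟩ | ⟨β, γ, ht, hA⟩) <;> simp [qact, ht, hA] <;> field_simp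

theorem disjoint_Dset_Dset' (K : Type*) [Field K] : Disjoint (Dset K) (Dset' K) := by
  rw [Set.disjoint_left]
  rintro g ⟨α, β, -, hA⟩ ⟨β', γ', -, hA'⟩
  have h00 := congrFun (congrFun (hA.symm.trans hA') 0) 0
  exact α.ne_zero h00

theorem Dset'_eq_image_mul_left {K : Type*} [Field K] {σ : Kˣ × GL (Fin 2) K}
    (hσ : σ ∈ Dset' K) : Dset' K = (fun h => σ * h) '' Dset K := by
  obtain ⟨β, γ, rfl⟩ := mem_Dset'_iff.1 hσ
  ext g
  constructor
  · intro hg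
    obtain ⟨β', γ', rfl⟩ := mem_Dset'_iff.1 hg
    refine ⟨diagHom K (γ⁻¹ * γ', β⁻¹ * β'), mem_Dset_iff.2 ⟨_, _, rfl⟩, ?_⟩
    simp only [antidiag_mul_diagHom, mul_inv_cancel_left]
  · rintro ⟨h, hh, rfl⟩
    obtain ⟨α, δ, rfl⟩ := mem_Dset_iff.1 hh
    exact mem_Dset'_iff.2 ⟨_, _, (antidiag_mul_diagHom β γ α δ).symm⟩

/-- The stabilizer of `(0,1,0)` (the form `z₁z₂`) is `D ∪ D′`; `D` is a subgroup of
index `2` in the stabilizer (it is a subgroup, `D` and `D′` are disjoint, and `D′` is a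
single left coset of `D`), and `(α,β) ↦ ((αβ)⁻¹, diag(α,β))` is a group isomorphism
`Kˣ × Kˣ ≃ D`. -/
theorem stmt5 {K : Type*} [Field K] (hchar : (2 : K) ≠ 0) :
    (∀ g : Kˣ × GL (Fin 2) K,
        qact g ((0 : K), (1 : K), (0 : K)) = ((0 : K), (1 : K), (0 : K)) ↔
          g ∈ Dset K ∪ Dset' K) ∧
    Disjoint (Dset K) (Dset' K) ∧
    (∃ S : Subgroup (Kˣ × GL (Fin 2) K), (S : Set (Kˣ × GL (Fin 2) K)) = Dset K ∧
      ∃ e : (Kˣ × Kˣ) ≃* S, ∀ α β : Kˣ,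
        (((e (α, β) : Kˣ × GL (Fin 2) K)).1 : K) = ((α : K) * (β : K))⁻¹ ∧
        (((e (α, β) : Kˣ × GL (Fin 2) K)).2 : Matrix (Fin 2) (Fin 2) K)
          = !![(α : K), 0; 0, (β : K)]) ∧
    (∀ σ : Kˣ × GL (Fin 2) K, σ ∈ Dset' K → Dset' K = (fun h => σ * h) '' Dset K) := by
  refine ⟨qact_eq_self_iff, disjoint_Dset_Dset' K, ⟨(diagHom K).range, ?_,
    MonoidHom.ofInjective (diagHom_injective K), fun α β => ⟨?_, ?_⟩⟩,
    fun σ hσ => Dset'_eq_image_mul_left hσ⟩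
  · ext g
    simp [mem_Dset_iff]
  · rw [MonoidHom.ofInjective_apply]
    simp [diagHom, mul_comm]
  · rfl
end

section
/- Let d ∈ K^× be a non-square, L = K(√d), and x = (1, 0, −d) (the form z₁² − d·z₂², so P(x) = 4d). Then: (i) the set H = {((a² − d b²)⁻¹, [[a,b],[d·b,a]]) : a, b ∈ K, (a,b) ≠ (0,0)} is a subgroup of Stab_{G_K}(x), and the map L^× → H sending a + b√d to ((a² − d b²)⁻¹, [[a,b],[d·b,a]]) is a group isomorphism; (ii) Stab_{G_K}(x) = H ∪ H·σ where σ = (1, diag(1,−1)) and σ ∉ H; in particular H has index 2 in Stab_{G_K}(x). -/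
open Matrix

/-- If `r ^ 2 = d` with `d` a non-square in `K`, coordinates with respect to `1, r` are unique. -/
theorem coords_unique {K L : Type*} [Field K] [Field L] [Algebra K L] {d : K}
    (hdsq : ¬ IsSquare d) {r : L} (hr : r ^ 2 = algebraMap K L d) {a b a' b' : K}
    (h : algebraMap K L a + algebraMap K L b * r =
      algebraMap K L a' + algebraMap K L b' * r) : a = a' ∧ b = b' := by
  have hb : b = b' := by
    by_contra hne
    have h0 : b - b' ≠ 0 := sub_ne_zero.mpr hne
    have hsq : (a' - a) ^ 2 = (b - b') ^ 2 * d := by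
      apply (algebraMap K L).injective
      have h1 : algebraMap K L a' - algebraMap K L a =
          (algebraMap K L b - algebraMap K L b') * r := by linear_combination -h
      simp only [map_pow, map_mul, map_sub, h1, ← hr]
      ring
    refine hdsq ⟨(a' - a) / (b - b'), ?_⟩
    field_simp
    linear_combination -hsq
  subst hb
  exact ⟨(algebraMap K L).injective (by linear_combination h), rfl⟩

/-- The norm form `a² - d b²` is anisotropic when `d` is not a square. -/
theorem norm_form_ne_zero {K : Type*} [Field K] {d : K} (hdsq : ¬ IsSquare d) {a b : K}
    (hab : ¬(a = 0 ∧ b = 0)) : a ^ 2 - d * b ^ 2 ≠ 0 := by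
  intro h
  by_cases hb : b = 0
  · subst hb
    exact hab ⟨by simpa using h, rfl⟩
  · refine hdsq ⟨a / b, ?_⟩
    field_simp
    linear_combination -h

/-- The embedding `γ ↦ (N(γ)⁻¹, M(γ))` of `Lˣ` into `Kˣ × GL₂(K)`, where
`M(a + b r) = !![a, b; d * b, a]`. -/
theorem exists_torus_hom {K L : Type*} [Field K] [Field L] [Algebra K L] {d : K}
    (hdsq : ¬ IsSquare d) {r : L} (hr : r ^ 2 = algebraMap K L d)
    (hgen : ∀ z : L, ∃ a b : K, z = algebraMap K L a + algebraMap K L b * r) :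
    ∃ φ : Lˣ →* Kˣ × GL (Fin 2) K, ∀ (γ : Lˣ) (a b : K),
      (γ : L) = algebraMap K L a + algebraMap K L b * r →
        ((φ γ).1 : K) = (a ^ 2 - d * b ^ 2)⁻¹ ∧
        ((φ γ).2 : Matrix (Fin 2) (Fin 2) K) = !![a, b; d * b, a] := by
  choose p q hpq using hgen
  have key : ∀ (z : L) (a b : K), z = algebraMap K L a + algebraMap K L b * r →
      p z = a ∧ q z = b := fun z a b hz =>
    coords_unique hdsq hr ((hpq z).symm.trans hz)
  let M : L →* Matrix (Fin 2) (Fin 2) K :=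
    { toFun := fun z => !![p z, q z; d * q z, p z]
      map_one' := by
        obtain ⟨h1, h2⟩ := key 1 1 0 (by simp)
        rw [h1, h2, Matrix.one_fin_two, mul_zero]
      map_mul' := fun y z => by
        obtain ⟨h1, h2⟩ := key (y * z) (p y * p z + d * (q y * q z)) (p y * q z + q y * p z) (by
          conv_lhs => rw [hpq y, hpq z]
          simp only [map_add, map_mul, ← hr]
          ring)
        rw [h1, h2, Matrix.mul_fin_two]
        congr! 3 <;> ring_nf }
  let u : Lˣ →* GL (Fin 2) K := Units.map M
  have hM : ∀ (γ : Lˣ) (a b : K), (γ : L) = algebraMap K L a + algebraMap K L b * r →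
      (u γ : Matrix (Fin 2) (Fin 2) K) = !![a, b; d * b, a] := fun γ a b h => by
    obtain ⟨h1, h2⟩ := key γ a b h
    change !![p γ, q γ; d * q γ, p γ] = _
    rw [h1, h2]
  refine ⟨((Matrix.GeneralLinearGroup.det.comp u)⁻¹).prod u, fun γ a b h => ⟨?_, hM γ a b h⟩⟩
  change (((Matrix.GeneralLinearGroup.det (u γ))⁻¹ : Kˣ) : K) = _
  rw [Units.val_inv_eq_inv_val, Matrix.GeneralLinearGroup.val_det_apply, hM γ a b h,
    Matrix.det_fin_two_of]
  congr 1
  ring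

/-- The second row of a matrix preserving `z₁² - d z₂²` up to scaling is determined
by the first row up to sign. -/
theorem second_row_of_similitude {K : Type*} [Field K] {d : K} (hd : d ≠ 0)
    {a b c e : K} (hN : a ^ 2 - d * b ^ 2 ≠ 0) (h1 : a * c = d * (b * e))
    (h2 : c ^ 2 - d * e ^ 2 = -d * (a ^ 2 - d * b ^ 2)) :
    (c = d * b ∧ e = a) ∨ (c = -(d * b) ∧ e = -a) := by
  have he : (e - a) * (e + a) = 0 := by
    have : d * (a ^ 2 - d * b ^ 2) * ((e - a) * (e + a)) = 0 := by
      linear_combination -a ^ 2 * h2 + (a * c + d * (b * e)) * h1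
    exact (mul_eq_zero.mp this).resolve_left (mul_ne_zero hd hN)
  by_cases ha : a = 0
  · subst ha
    have he0 : e = 0 := by simpa using he
    subst he0
    have : (c - d * b) * (c + d * b) = 0 := by linear_combination h2
    rcases mul_eq_zero.mp this with h | h
    · exact Or.inl ⟨by linear_combination h, rfl⟩
    · exact Or.inr ⟨by linear_combination h, by simp⟩
  · rcases mul_eq_zero.mp he with h | h
    · have h' : e = a := by linear_combination h
      subst h'
      exact Or.inl ⟨mul_left_cancel₀ ha (by linear_combination h1), rfl⟩
    · have h' : e = -a := by linear_combination h
      subst h'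
      exact Or.inr ⟨mul_left_cancel₀ ha (by linear_combination h1), rfl⟩

/-- An element `(t, A)` fixes `z₁² - d z₂²` iff `t` is the inverse norm of the first row of `A` and
the second row is that of multiplication by `a + b √d`, up to sign. -/
theorem qact_eq_self_iff_s6 {K : Type*} [Field K] (hchar : (2 : K) ≠ 0) {d : K} (hd : d ≠ 0)
    (hdsq : ¬ IsSquare d) (g : Kˣ × GL (Fin 2) K) :
    qact g ((1 : K), (0 : K), -d) = ((1 : K), (0 : K), -d) ↔
      ∃ a b : K, ¬(a = 0 ∧ b = 0) ∧ (g.1 : K) = (a ^ 2 - d * b ^ 2)⁻¹ ∧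
        ((g.2 : Matrix (Fin 2) (Fin 2) K) = !![a, b; d * b, a] ∨
          (g.2 : Matrix (Fin 2) (Fin 2) K) = !![a, b; -(d * b), -a]) := by
  constructor
  · intro h
    simp only [qact, Prod.mk.injEq] at h
    obtain ⟨h1, h2, h3⟩ := h
    have ht : (g.1 : K) ≠ 0 := g.1.ne_zero
    have hA := Matrix.eta_fin_two (g.2 : Matrix (Fin 2) (Fin 2) K)
    generalize (g.2 : Matrix (Fin 2) (Fin 2) K) 0 0 = a at *
    generalize (g.2 : Matrix (Fin 2) (Fin 2) K) 0 1 = b at *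
    generalize (g.2 : Matrix (Fin 2) (Fin 2) K) 1 0 = c at *
    generalize (g.2 : Matrix (Fin 2) (Fin 2) K) 1 1 = e at *
    have hN : (g.1 : K) * (a ^ 2 - d * b ^ 2) = 1 := by linear_combination h1
    refine ⟨a, b, ?_, eq_inv_of_mul_eq_one_left hN, ?_⟩
    · rintro ⟨rfl, rfl⟩
      simp at hN
    · have hac : a * c = d * (b * e) :=
        mul_left_cancel₀ (mul_ne_zero ht hchar) (by linear_combination h2)
      have hce : c ^ 2 - d * e ^ 2 = -d * (a ^ 2 - d * b ^ 2) :=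
        mul_left_cancel₀ ht (by linear_combination h3 + d * hN)
      rcases second_row_of_similitude hd (right_ne_zero_of_mul_eq_one hN) hac hce with
        ⟨rfl, rfl⟩ | ⟨rfl, rfl⟩
      · exact Or.inl hA
      · exact Or.inr hA
  · rintro ⟨a, b, hab, ht, hA⟩
    have hN := norm_form_ne_zero hdsq hab
    have hN' : (a ^ 2 - d * b ^ 2)⁻¹ * (a ^ 2 - d * b ^ 2) = 1 := inv_mul_cancel₀ hN
    rcases hA with hA | hA <;>
    · simp only [qact, ht, hA, Prod.mk.injEq, Matrix.of_apply, Matrix.cons_val', Matrix.cons_val_zero,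
        Matrix.cons_val_one, Matrix.cons_val_fin_one]
      exact ⟨by linear_combination hN', by ring, by linear_combination -d * hN'⟩

/-- Let `d ∈ Kˣ` be a non-square, `L = K(√d)` and `x = (1, 0, -d)` (the form `z₁² - d z₂²`).
Then `H = {((a² - db²)⁻¹, [[a,b],[db,a]]) : (a,b) ≠ (0,0)}` is a subgroup of the stabilizer
of `x`, the map `a + b√d ↦ ((a² - db²)⁻¹, [[a,b],[db,a]])` is a group isomorphism
`Lˣ ≃ H`, and the stabilizer is `H ∪ H·σ` with `σ = (1, diag(1,-1)) ∉ H`, so `H` has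
index `2` in the stabilizer. -/
theorem stmt6 {K : Type*} [Field K] (hchar : (2 : K) ≠ 0)
    (d : K) (hd : d ≠ 0) (hdsq : ¬ IsSquare d)
    (L : Type*) [Field L] [Algebra K L] (r : L)
    (hr : r ^ 2 = algebraMap K L d)
    (hgen : ∀ z : L, ∃ a b : K, z = algebraMap K L a + algebraMap K L b * r) :
    ∃ S : Subgroup (Kˣ × GL (Fin 2) K),
      (S : Set (Kˣ × GL (Fin 2) K)) =
        {g | ∃ a b : K, ¬(a = 0 ∧ b = 0) ∧
          (g.1 : K) = (a ^ 2 - d * b ^ 2)⁻¹ ∧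
          (g.2 : Matrix (Fin 2) (Fin 2) K) = !![a, b; d * b, a]} ∧
      (∀ g ∈ S, qact g ((1 : K), (0 : K), -d) = ((1 : K), (0 : K), -d)) ∧
      (∃ e : Lˣ ≃* S, ∀ (γ : Lˣ) (a b : K),
        (γ : L) = algebraMap K L a + algebraMap K L b * r →
          (((e γ : Kˣ × GL (Fin 2) K)).1 : K) = (a ^ 2 - d * b ^ 2)⁻¹ ∧
          (((e γ : Kˣ × GL (Fin 2) K)).2 : Matrix (Fin 2) (Fin 2) K) = !![a, b; d * b, a]) ∧
      (∀ σ : Kˣ × GL (Fin 2) K,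
        (σ.1 : K) = 1 → (σ.2 : Matrix (Fin 2) (Fin 2) K) = !![1, 0; 0, -1] →
          σ ∉ (S : Set (Kˣ × GL (Fin 2) K)) ∧
          (∀ g : Kˣ × GL (Fin 2) K,
            qact g ((1 : K), (0 : K), -d) = ((1 : K), (0 : K), -d) ↔
              (g ∈ S ∨ ∃ h ∈ S, g = h * σ))) := by
  obtain ⟨φ, hφ⟩ := exists_torus_hom hdsq hr hgen
  have hcoord : ∀ γ : Lˣ, ∃ a b : K, ¬(a = 0 ∧ b = 0) ∧
      (γ : L) = algebraMap K L a + algebraMap K L b * r := fun γ => by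
    obtain ⟨a, b, h⟩ := hgen γ
    refine ⟨a, b, ?_, h⟩
    rintro ⟨rfl, rfl⟩
    simp at h
  have hinj : Function.Injective φ := fun γ δ h => by
    obtain ⟨a, b, -, hγ⟩ := hcoord γ
    obtain ⟨a', b', -, hδ⟩ := hcoord δ
    have hm := (hφ γ a b hγ).2
    rw [h, (hφ δ a' b' hδ).2] at hm
    have ha : a' = a := congrFun (congrFun hm 0) 0
    have hb : b' = b := congrFun (congrFun hm 0) 1
    exact Units.ext (by rw [hγ, hδ, ha, hb])
  have hmem : ∀ g : Kˣ × GL (Fin 2) K, g ∈ φ.range ↔ ∃ a b : K, ¬(a = 0 ∧ b = 0) ∧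
      (g.1 : K) = (a ^ 2 - d * b ^ 2)⁻¹ ∧
      (g.2 : Matrix (Fin 2) (Fin 2) K) = !![a, b; d * b, a] := fun g => by
    constructor
    · rintro ⟨γ, rfl⟩
      obtain ⟨a, b, hab, hγ⟩ := hcoord γ
      exact ⟨a, b, hab, hφ γ a b hγ⟩
    · rintro ⟨a, b, hab, ht, hA⟩
      have hz : algebraMap K L a + algebraMap K L b * r ≠ 0 := fun h =>
        hab (coords_unique hdsq hr (a' := 0) (b' := 0) (by simp [h]))
      obtain ⟨h1, h2⟩ := hφ (Units.mk0 _ hz) a b rfl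
      exact ⟨Units.mk0 _ hz, Prod.ext (Units.ext (h1.trans ht.symm)) (Units.ext (h2.trans hA.symm))⟩
  refine ⟨φ.range, Set.ext hmem, fun g hg => ?_, ⟨MonoidHom.ofInjective hinj, hφ⟩, ?_⟩
  · obtain ⟨a, b, hab, ht, hA⟩ := (hmem g).mp hg
    exact (qact_eq_self_iff_s6 hchar hd hdsq g).mpr ⟨a, b, hab, ht, Or.inl hA⟩
  intro σ hσ₁ hσ₂
  have hσσ : σ * σ = 1 := by
    refine Prod.ext (Units.ext ?_) (Units.ext ?_)
    · simp [hσ₁]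
    · simp [hσ₂, Matrix.one_fin_two]
  have hmulσ : ∀ (g : Kˣ × GL (Fin 2) K) (a b c e : K),
      (g.2 : Matrix (Fin 2) (Fin 2) K) = !![a, b; c, e] →
      ((g * σ).2 : Matrix (Fin 2) (Fin 2) K) = !![a, -b; c, -e] := fun g a b c e h => by
    simp [h, hσ₂]
  have hmulσ₁ : ∀ g : Kˣ × GL (Fin 2) K, ((g * σ).1 : K) = g.1 := fun g => by simp [hσ₁]
  refine ⟨fun hσ => ?_, fun g => ?_⟩
  · obtain ⟨a, b, -, -, hA⟩ := (hmem σ).mp hσ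
    rw [hσ₂] at hA
    have h0 : (1 : K) = a := congrFun (congrFun hA 0) 0
    have h1 : (-1 : K) = a := congrFun (congrFun hA 1) 1
    exact hchar (by linear_combination h0 - h1)
  rw [qact_eq_self_iff_s6 hchar hd hdsq]
  constructor
  · rintro ⟨a, b, hab, ht, hA | hA⟩
    · exact Or.inl ((hmem g).mpr ⟨a, b, hab, ht, hA⟩)
    · refine Or.inr ⟨g * σ, (hmem _).mpr ⟨a, -b, by simpa using hab, ?_, ?_⟩, ?_⟩
      · rw [hmulσ₁, ht, neg_sq]
      · rw [hmulσ g _ _ _ _ hA, mul_neg, neg_neg]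
      · rw [mul_assoc, hσσ, mul_one]
  · rintro (hg | ⟨h, hh, rfl⟩)
    · obtain ⟨a, b, hab, ht, hA⟩ := (hmem g).mp hg
      exact ⟨a, b, hab, ht, Or.inl hA⟩
    · obtain ⟨a, b, hab, ht, hA⟩ := (hmem h).mp hh
      refine ⟨a, -b, by simpa using hab, ?_, Or.inr ?_⟩
      · rw [hmulσ₁, ht, neg_sq]
      · rw [hmulσ h _ _ _ _ hA, mul_neg, neg_neg]
end

section
/- Let R be a finite commutative local ring whose maximal ideal m satisfies m² = 0 and is principal, generated by an element π ≠ 0; let q = |R/m| and assume q is odd (so |R| = q²). Let G_R = R^× × GL₂(R) act on V_R = R³ by the binary-quadratic-form action, and let x = (1, 0, −π) ∈ V_R. Then the stabilizer of x in G_R has exactly 2(q−1)q⁴ elements, and consequently the G_R-orbit of x has exactly q²(q−1)(q²−1)/2 elements. -/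
open Matrix

/-- For a surjective homomorphism of finite additive groups, the proportion of elements satisfying a
predicate is unchanged by pulling the predicate back. -/
theorem card_subtype_comp_mul_card {A B : Type*} [AddGroup A] [AddGroup B] [Finite A]
    (f : A →+ B) (hf : Function.Surjective f) (p : B → Prop) :
    Nat.card {a // p (f a)} * Nat.card B = Nat.card {b // p b} * Nat.card A := by
  have : Finite B := Finite.of_surjective f hf
  have key (r : B → Prop) : Nat.card {a // r (f a)} = Nat.card {b // r b} * Nat.card f.ker := by
    rw [← Nat.card_prod]
    exact Nat.card_congr ((Equiv.sigmaSubtypeFiberEquivSubtype f (fun _ ↦ Iff.rfl)).symm.trans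
      ((Equiv.sigmaCongrRight fun b : {b // r b} ↦ f.fiberEquivKerOfSurjective hf b.1).trans
        (Equiv.sigmaEquivProd _ _)))
  have h := key fun _ ↦ True
  rw [Nat.card_congr (Equiv.subtypeUnivEquiv fun _ ↦ trivial),
    Nat.card_congr (Equiv.subtypeUnivEquiv fun _ ↦ trivial)] at h
  rw [key p, h]
  ring

/-- The units of a monoid as the subtype of invertible elements. -/
theorem card_units_eq_card_isUnit (M : Type*) [Monoid M] :
    Nat.card Mˣ = Nat.card {x : M // IsUnit x} :=
  Nat.card_congr <| Equiv.ofBijective (fun u ↦ ⟨u, u.isUnit⟩)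
    ⟨fun _ _ h ↦ Units.ext (congrArg Subtype.val h), fun ⟨_, u, h⟩ ↦ ⟨u, Subtype.ext h⟩⟩

namespace IsLocalRing

variable {R : Type*} [CommRing R] [IsLocalRing R]

theorem card_units_mul_card_residueField [Finite R] :
    Nat.card Rˣ * Nat.card (ResidueField R) = Nat.card (ResidueField R)ˣ * Nat.card R := by
  rw [card_units_eq_card_isUnit, card_units_eq_card_isUnit,
    ← card_subtype_comp_mul_card (residue R).toAddMonoidHom residue_surjective]
  congr 1
  refine Nat.card_congr (Equiv.subtypeEquivRight fun x ↦ ?_)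
  simp

theorem card_GL_mul_card_residueField_pow [Finite R] (n : Type*) [Fintype n] [DecidableEq n] :
    Nat.card (GL n R) * Nat.card (Matrix n n (ResidueField R)) =
      Nat.card (GL n (ResidueField R)) * Nat.card (Matrix n n R) := by
  rw [card_units_eq_card_isUnit, card_units_eq_card_isUnit,
    ← card_subtype_comp_mul_card (residue R).mapMatrix.toAddMonoidHom
      (fun M ↦ ⟨M.map (Function.surjInv residue_surjective), by
        ext; simp [Function.surjInv_eq]⟩)]
  congr 1
  refine Nat.card_congr (Equiv.subtypeEquivRight fun x ↦ ?_)
  simp only [RingHom.toAddMonoidHom_eq_coe, AddMonoidHom.coe_coe]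
  rw [Matrix.isUnit_iff_isUnit_det, Matrix.isUnit_iff_isUnit_det, ← RingHom.map_det]
  simp

theorem card_maximalIdeal_of_sq_eq_bot {π : R} (hπ0 : π ≠ 0)
    (hgen : maximalIdeal R = Ideal.span {π}) (hsq : maximalIdeal R ^ 2 = ⊥) :
    Nat.card (maximalIdeal R) = Nat.card (R ⧸ maximalIdeal R) := by
  have htors : Ideal.torsionOf R R π = maximalIdeal R := by
    ext r
    rw [Ideal.mem_torsionOf_iff, smul_eq_mul]
    refine ⟨fun h hr ↦ hπ0 ?_, fun h ↦ ?_⟩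
    · exact (IsUnit.mul_right_eq_zero hr).1 h
    · have := Ideal.mul_mem_mul h (hgen ▸ Ideal.mem_span_singleton_self π : π ∈ maximalIdeal R)
      rwa [← sq, hsq] at this
  have h := Nat.card_congr (Ideal.quotTorsionOfEquivSpanSingleton R R π).toEquiv
  rw [htors] at h
  rw [h, hgen]

theorem card_eq_sq_of_sq_eq_bot {π : R} (hπ0 : π ≠ 0)
    (hgen : maximalIdeal R = Ideal.span {π}) (hsq : maximalIdeal R ^ 2 = ⊥) :
    Nat.card R = Nat.card (R ⧸ maximalIdeal R) ^ 2 := by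
  have h := AddSubgroup.card_eq_card_quotient_mul_card_addSubgroup
    (Submodule.toAddSubgroup (maximalIdeal R))
  rw [h, sq]
  congr 1
  exact card_maximalIdeal_of_sq_eq_bot hπ0 hgen hsq

end IsLocalRing

/-- `qact` as a left action of `Kˣ × GL₂(K)` on triples. -/
abbrev qactMulAction (K : Type*) [CommRing K] : MulAction (Kˣ × GL (Fin 2) K) (K × K × K) where
  smul := qact
  one_smul x := by
    change qact 1 x = x
    simp [qact]
  mul_smul g h x := by
    change qact (g * h) x = qact g (qact h x)
    simp only [qact, Prod.fst_mul, Prod.snd_mul, Units.val_mul, Matrix.mul_apply,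
      Fin.sum_univ_two, Prod.mk.injEq]
    refine ⟨?_, ?_, ?_⟩ <;> ring

theorem card_qact_orbit_mul_card_stabilizer {K : Type*} [CommRing K] (x : K × K × K) :
    Nat.card {y // ∃ g, qact g x = y} * Nat.card {g // qact g x = x} =
      Nat.card (Kˣ × GL (Fin 2) K) := by
  let := qactMulAction K
  rw [← (MulAction.stabilizer (Kˣ × GL (Fin 2) K) x).index_mul_card, MulAction.index_stabilizer]
  rfl

open IsLocalRing in
theorem card_qact_stabilizer {R : Type*} [CommRing R] [IsLocalRing R] {π : R}
    (h2 : IsUnit (2 : R)) (hπ0 : π ≠ 0)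
    (hgen : maximalIdeal R = Ideal.span {π}) (hsq : maximalIdeal R ^ 2 = ⊥) :
    Nat.card {g : Rˣ × GL (Fin 2) R // qact g (1, 0, -π) = (1, 0, -π)} =
      Nat.card (Rˣ × R × ℤˣ × maximalIdeal R) := by
  have hπ : π ∈ maximalIdeal R := hgen ▸ Ideal.mem_span_singleton_self π
  have hmul {x y : R} (hx : x ∈ maximalIdeal R) (hy : y ∈ maximalIdeal R) : x * y = 0 := by
    have := Ideal.mul_mem_mul hx hy
    rwa [← sq, hsq] at this
  have hππ := hmul hπ hπ
  have hunit {u e : R} (hu : IsUnit u) (he : e ∈ maximalIdeal R) : IsUnit (u + e) := by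
    by_contra h
    exact (mem_maximalIdeal u).1 ((Ideal.add_mem_iff_left _ he).1 ((mem_maximalIdeal _).2 h)) hu
  have hN (a : Rˣ) (b : R) : IsUnit ((a : R) ^ 2 + -π * b ^ 2) :=
    hunit (a.isUnit.pow 2) (Ideal.mul_mem_right _ _ (neg_mem hπ))
  have hsign (s : ℤˣ) : ((s : ℤ) : R) ^ 2 = 1 := by
    rcases Int.units_eq_one_or s with rfl | rfl <;> simp
  have hD (p : Rˣ × R × ℤˣ × maximalIdeal R) :
      IsUnit (!![(p.1 : R), p.2.1;
        π * p.2.1 * ((p.2.2.1 : ℤ) * p.1 + p.2.2.2) * ↑p.1⁻¹,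
        (p.2.2.1 : ℤ) * p.1 + p.2.2.2]).det := by
    obtain ⟨a, b, s, e, he⟩ := p
    rw [Matrix.det_fin_two_of, sub_eq_add_neg]
    refine hunit (a.isUnit.mul (hunit (IsUnit.mul ?_ a.isUnit) he)) (neg_mem ?_)
    · exact IsUnit.of_mul_eq_one _ (by rw [← sq]; exact hsign s)
    · rw [show b * (π * b * ((s : ℤ) * (a : R) + e) * ↑a⁻¹)
        = π * (b * (b * ((s : ℤ) * (a : R) + e) * ↑a⁻¹)) by ring]
      exact Ideal.mul_mem_right _ _ hπ
  have hfix (p : Rˣ × R × ℤˣ × maximalIdeal R) :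
      qact ((hN p.1 p.2.1).unit⁻¹, Matrix.GeneralLinearGroup.mk'' _ (hD p)) (1, 0, -π) =
        (1, 0, -π) := by
    obtain ⟨a, b, s, e, he⟩ := p
    have ht := (hN a b).val_inv_mul
    have ha := a.mul_inv
    have hs := hsign s
    have hπe := hmul hπ he
    generalize hg : Matrix.GeneralLinearGroup.mk'' _ (hD _) = g
    replace hg : g.1 = !![(a : R), b; π * b * ((s : ℤ) * a + e) * ↑a⁻¹, (s : ℤ) * a + e] :=
      hg ▸ rfl
    simp only [qact, hg, Prod.mk.injEq, Matrix.of_apply, Matrix.cons_val_zero, Matrix.cons_val_one,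
      Matrix.cons_val', Matrix.cons_val_fin_one]
    generalize (↑(hN a b).unit⁻¹ : R) = t at ht ⊢
    generalize (↑a⁻¹ : R) = a' at ha ⊢
    generalize ((s : ℤ) : R) = s' at hs ⊢
    refine ⟨?_, ?_, ?_⟩
    · linear_combination ht
    · linear_combination 2 * t * π * b * (s' * a + e) * ha
    · linear_combination (t * (b * (s' * a + e) * a') ^ 2 - t * b ^ 2) * hππ
        - t * (2 * s' * a + e) * hπe - t * π * a ^ 2 * hs - π * ht
  symm
  refine Nat.card_eq_of_bijective (fun p ↦ ⟨_, hfix p⟩) ⟨?_, ?_⟩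
  · rintro ⟨a, b, s, e⟩ ⟨a', b', s', e'⟩ h
    have hent (i j : Fin 2) := congrArg (fun g ↦ (g.1.2 : Matrix (Fin 2) (Fin 2) R) i j) h
    obtain rfl : a = a' := Units.ext (hent 0 0)
    obtain rfl : b = b' := hent 0 1
    have hd : ((s : ℤ) : R) * a + e = (s' : ℤ) * a + e' := hent 1 1
    have h2a {x y : R} (hx : x ∈ maximalIdeal R) (hy : y ∈ maximalIdeal R)
        (hxy : 2 * (a : R) = x - y) : False :=
      (mem_maximalIdeal _).1 (hxy ▸ sub_mem hx hy) (h2.mul a.isUnit)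
    obtain rfl : s = s' := by
      rcases Int.units_eq_one_or s with rfl | rfl <;>
        rcases Int.units_eq_one_or s' with rfl | rfl <;> try rfl
      · push_cast at hd
        exact (h2a e'.2 e.2 (by linear_combination hd)).elim
      · push_cast at hd
        exact (h2a e.2 e'.2 (by linear_combination -hd)).elim
    obtain rfl : e = e' := Subtype.ext (add_left_cancel hd)
    rfl
  · rintro ⟨⟨t, A⟩, h⟩
    obtain ⟨h₁, h₂, h₃⟩ := by simpa only [qact, Prod.mk.injEq] using h
    generalize ha : A.1 0 0 = a at h₁ h₂ h₃
    generalize hb : A.1 0 1 = b at h₁ h₂ h₃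
    generalize hc : A.1 1 0 = c at h₁ h₂ h₃
    generalize hd : A.1 1 1 = d at h₁ h₂ h₃
    have hau : IsUnit a := by
      rw [← isUnit_pow_iff two_ne_zero]
      have := hunit (e := π * b ^ 2) (IsUnit.of_mul_eq_one_right _ h₁) (Ideal.mul_mem_right _ _ hπ)
      convert this using 1
      ring
    obtain ⟨a, rfl⟩ := hau
    have hac : a * c = π * b * d := by
      rw [← sub_eq_zero, ← (t.isUnit.mul h2).mul_right_eq_zero]
      linear_combination h₂
    have hc' : c = π * b * d * ↑a⁻¹ := by
      rw [Units.eq_mul_inv_iff_mul_eq, ← hac, mul_comm]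
    have hcc : c ^ 2 = 0 := by
      rw [hc']
      linear_combination (b * d * ↑a⁻¹) ^ 2 * hππ
    have hda : π * ((d - a) * (d + a)) = 0 := by
      rw [← t.isUnit.mul_right_eq_zero]
      linear_combination t * hcc - h₃ - π * h₁ - t * b ^ 2 * hππ
    have hmem : (d - a) * (d + a) ∈ maximalIdeal R :=
      (mem_maximalIdeal _).2 fun hu ↦ hπ0 (hu.mul_left_eq_zero.1 hda)
    obtain ⟨s, e, hse⟩ : ∃ (s : ℤˣ) (e : maximalIdeal R), ((s : ℤ) : R) * a + e = d := by
      rcases Ideal.IsPrime.mem_or_mem inferInstance hmem with h | h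
      · exact ⟨1, ⟨_, h⟩, by simp⟩
      · exact ⟨-1, ⟨_, h⟩, by simp⟩
    refine ⟨(a, b, s, e), Subtype.ext (Prod.ext (Units.ext ?_) (Units.ext ?_))⟩
    · refine Units.inv_eq_of_mul_eq_one_left ?_
      change (t : R) * (a ^ 2 + -π * b ^ 2) = 1
      linear_combination h₁
    · change !![_, _; _, _] = A.1
      rw [Matrix.eta_fin_two A.1, ha, hb, hc, hd, hc', ← hse]

/-- Let `R` be a finite commutative local ring with principal maximal ideal `m = (π)`,
`π ≠ 0`, `m² = 0`, `q = |R/m|` odd. For `x = (1, 0, -π)`, the stabilizer of `x` in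
`G_R = Rˣ × GL₂(R)` has `2(q-1)q⁴` elements and the orbit of `x` has
`q²(q-1)(q²-1)/2` elements. -/
theorem stmt9 {R : Type*} [CommRing R] [Finite R] [IsLocalRing R]
    (π : R) (hπ0 : π ≠ 0)
    (hgen : IsLocalRing.maximalIdeal R = Ideal.span {π})
    (hsq : (IsLocalRing.maximalIdeal R) ^ 2 = ⊥)
    (q : ℕ) (hq : q = Nat.card (R ⧸ IsLocalRing.maximalIdeal R)) (hodd : Odd q) :
    Nat.card {g : Rˣ × GL (Fin 2) R //
        qact g ((1 : R), (0 : R), -π) = ((1 : R), (0 : R), -π)} = 2 * (q - 1) * q ^ 4 ∧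
    Nat.card {y : R × R × R // ∃ g : Rˣ × GL (Fin 2) R, qact g ((1 : R), (0 : R), -π) = y}
      = q ^ 2 * (q - 1) * (q ^ 2 - 1) / 2 := by
  have : Finite (IsLocalRing.ResidueField R) := Finite.of_surjective _ IsLocalRing.residue_surjective
  have hq' : Nat.card (IsLocalRing.ResidueField R) = q := hq.symm
  have hm : Nat.card (IsLocalRing.maximalIdeal R) = q :=
    hq ▸ IsLocalRing.card_maximalIdeal_of_sq_eq_bot hπ0 hgen hsq
  have hR : Nat.card R = q ^ 2 := hq ▸ IsLocalRing.card_eq_sq_of_sq_eq_bot hπ0 hgen hsq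
  have hq1 : 1 < q := hq' ▸ Finite.one_lt_card
  have h2 : IsUnit (2 : R) := by
    rw [← IsLocalRing.residue_ne_zero_iff_isUnit, map_ofNat]
    intro h
    obtain ⟨j, hj⟩ := hodd
    have h0 := card_nsmul_eq_zero' (G := IsLocalRing.ResidueField R) (x := 1)
    rw [hq', hj, nsmul_one] at h0
    push_cast at h0
    rw [h, zero_mul, zero_add] at h0
    exact one_ne_zero h0
  have hunits : Nat.card Rˣ = (q - 1) * q := by
    have h := IsLocalRing.card_units_mul_card_residueField (R := R)
    rw [Nat.card_units, hq', hR] at h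
    exact Nat.eq_of_mul_eq_mul_right (by lia : 0 < q) (by rw [h]; ring)
  have hGL : Nat.card (GL (Fin 2) R) = (q ^ 2 - 1) * (q ^ 2 - q) * q ^ 4 := by
    have h := IsLocalRing.card_GL_mul_card_residueField_pow (R := R) (Fin 2)
    have : Fintype (IsLocalRing.ResidueField R) := Fintype.ofFinite _
    have hmat (S : Type _) : Nat.card (Matrix (Fin 2) (Fin 2) S) = Nat.card S ^ 4 := by
      simp [Matrix, Nat.card_fun, ← pow_mul]
    rw [Matrix.card_GL_field, hmat, hmat, ← Nat.card_eq_fintype_card, hq', hR] at h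
    simp only [Fin.prod_univ_two, Fin.val_zero, Fin.val_one, pow_zero, pow_one] at h
    exact Nat.eq_of_mul_eq_mul_right (by positivity : 0 < q ^ 4) (by rw [h]; ring)
  have hstab := card_qact_stabilizer h2 hπ0 hgen hsq
  rw [Nat.card_prod, Nat.card_prod, Nat.card_prod, hunits, hR, hm,
    Nat.card_eq_fintype_card (α := ℤˣ), Fintype.card_units_int] at hstab
  have horb := card_qact_orbit_mul_card_stabilizer ((1 : R), (0 : R), -π)
  rw [hstab, Nat.card_prod, hunits, hGL] at horb
  refine ⟨by rw [hstab]; ring, ?_⟩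
  have hqq : q ^ 2 - q = q * (q - 1) := by rw [Nat.mul_sub, sq, mul_one]
  refine (Nat.div_eq_of_eq_mul_left two_pos ?_).symm
  have hpos : 0 < (q - 1) * q ^ 4 := Nat.mul_pos (by lia) (by positivity)
  refine Nat.eq_of_mul_eq_mul_right hpos ?_
  rw [hqq] at horb
  linear_combination -horb
end
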